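/- For every natural number n ≥ 1 and every p ∈ (0,1), the total variation distance between the binomial distribution with parameters n and p and the Poisson distribution with parameter n·λ*_p, where λ*_p := min(-ln(1-p), 1), satisfies: d_tv(X_{n,p}, Π_{nλ*_p}) ≤ n·(p + (1-p)·ln(1-p)) if p ≤ 1 - e^{-1}, and d_tv(X_{n,p}, Π_{nλ*_p}) ≤ n·(p - e^{-1}) if p ≥ 1 - e^{-1}. -/

import Mathlib

/-- The Binomial(n, p) probability mass function on ℕ (zero for k > n). -/
noncomputable def binomPMF (n : ℕ) (p : ℝ) : ℕ → ℝ :=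
  fun k => (n.choose k : ℝ) * p ^ k * (1 - p) ^ (n - k)

/-- The Poisson(l) probability mass function on ℕ. -/
noncomputable def poissonPMF (l : ℝ) : ℕ → ℝ :=
  fun k => Real.exp (-l) * l ^ k / (Nat.factorial k)

/-- Total variation distance between two distributions on ℕ. -/
noncomputable def dtv (P Q : ℕ → ℝ) : ℝ := (1 / 2) * ∑' k : ℕ, |P k - Q k|

open Finset in
/-- The total variation distance is subadditive under convolution of probability distributions. -/
theorem dtv_convolution_le {f f' g g' : ℕ → ℝ} (hf : HasSum f 1) (hf' : HasSum f' 1)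
    (hg : HasSum g 1) (hg' : HasSum g' 1) (hf'0 : ∀ k, 0 ≤ f' k) (hg0 : ∀ k, 0 ≤ g k) :
    dtv (fun k => ∑ x ∈ antidiagonal k, f x.1 * g x.2)
      (fun k => ∑ x ∈ antidiagonal k, f' x.1 * g' x.2) ≤ dtv f f' + dtv g g' := by
  have hdf : Summable fun k => |f k - f' k| := (hf.summable.sub hf'.summable).abs
  have hdg : Summable fun k => |g k - g' k| := (hg.summable.sub hg'.summable).abs
  have key {u v : ℕ → ℝ} (hu : Summable u) (hv : Summable v) (hu0 : ∀ k, 0 ≤ u k)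
      (hv0 : ∀ k, 0 ≤ v k) : HasSum (fun k => ∑ x ∈ antidiagonal k, u x.1 * v x.2)
        ((∑' k, u k) * ∑' k, v k) := by
    rw [tsum_mul_tsum_eq_tsum_sum_antidiagonal_of_summable_norm hu.norm hv.norm]
    exact (summable_norm_sum_mul_antidiagonal_of_summable_norm hu.norm hv.norm).of_norm.hasSum
  have h := (key hdf hg.summable (fun _ => abs_nonneg _) hg0).add
    (key hf'.summable hdg hf'0 fun _ => abs_nonneg _)
  rw [hg.tsum_eq, hf'.tsum_eq, mul_one, one_mul] at h
  have hle (k : ℕ) : |∑ x ∈ antidiagonal k, f x.1 * g x.2 - ∑ x ∈ antidiagonal k, f' x.1 * g' x.2|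
      ≤ ∑ x ∈ antidiagonal k, |f x.1 - f' x.1| * g x.2 +
        ∑ x ∈ antidiagonal k, f' x.1 * |g x.2 - g' x.2| := by
    rw [← sum_sub_distrib, ← sum_add_distrib]
    refine (abs_sum_le_sum_abs _ _).trans (sum_le_sum fun x _ => ?_)
    calc |f x.1 * g x.2 - f' x.1 * g' x.2|
        = |(f x.1 - f' x.1) * g x.2 + f' x.1 * (g x.2 - g' x.2)| := by ring_nf
      _ ≤ _ := (abs_add_le _ _).trans_eq (by
        rw [abs_mul, abs_mul, abs_of_nonneg (hg0 _), abs_of_nonneg (hf'0 _)])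
  have := (h.summable.of_nonneg_of_le (fun _ => abs_nonneg _) hle).tsum_le_tsum hle h.summable
  rw [h.tsum_eq] at this
  unfold dtv
  linarith

theorem binomPMF_nonneg {p : ℝ} (hp0 : 0 ≤ p) (hp1 : p ≤ 1) (n k : ℕ) : 0 ≤ binomPMF n p k := by
  have := sub_nonneg.2 hp1
  unfold binomPMF
  positivity

theorem poissonPMF_nonneg {l : ℝ} (hl : 0 ≤ l) (k : ℕ) : 0 ≤ poissonPMF l k := by
  unfold poissonPMF
  positivity

theorem hasSum_binomPMF (n : ℕ) (p : ℝ) : HasSum (binomPMF n p) 1 := by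
  have h : ∑ k ∈ Finset.range (n + 1), binomPMF n p k = 1 := by
    rw [← one_pow (M := ℝ) n, ← add_sub_cancel p 1, add_pow]
    refine Finset.sum_congr rfl fun k _ => ?_
    rw [binomPMF]
    ring
  rw [← h]
  refine hasSum_sum_of_ne_finset_zero fun k hk => ?_
  rw [binomPMF, Nat.choose_eq_zero_of_lt (by simpa using hk)]
  simp

theorem hasSum_poissonPMF (l : ℝ) : HasSum (poissonPMF l) 1 := by
  have h := (NormedSpace.expSeries_div_hasSum_exp l).mul_left (Real.exp (-l))
  unfold poissonPMF
  rw [← Real.exp_eq_exp_ℝ, ← Real.exp_add, neg_add_cancel, Real.exp_zero] at h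
  simpa only [mul_div_assoc] using h

open Finset in
theorem binomPMF_add (m n : ℕ) (p : ℝ) :
    binomPMF (m + n) p = fun k => ∑ x ∈ antidiagonal k, binomPMF m p x.1 * binomPMF n p x.2 := by
  ext k
  simp only [binomPMF]
  rw [Nat.add_choose_eq, Nat.cast_sum, sum_mul, sum_mul]
  refine sum_congr rfl fun x hx => ?_
  obtain rfl := mem_antidiagonal.1 hx
  rcases lt_or_ge m x.1 with h | h
  · simp [Nat.choose_eq_zero_of_lt h]
  rcases lt_or_ge n x.2 with h' | h'
  · simp [Nat.choose_eq_zero_of_lt h']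
  rw [show m + n - (x.1 + x.2) = (m - x.1) + (n - x.2) by omega]
  push_cast
  ring

open Finset in
theorem poissonPMF_add (l m : ℝ) :
    poissonPMF (l + m) = fun k => ∑ x ∈ antidiagonal k, poissonPMF l x.1 * poissonPMF m x.2 := by
  ext k
  simp only [poissonPMF]
  rw [(Commute.all l m).add_pow', mul_sum, sum_div]
  refine sum_congr rfl fun x hx => ?_
  obtain rfl := mem_antidiagonal.1 hx
  have h := Nat.add_choose_mul_factorial_mul_factorial x.1 x.2
  rw [← Nat.choose_symm_add] at h
  rw [← h, neg_add, Real.exp_add, nsmul_eq_mul]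
  have hc : ((x.1 + x.2).choose x.1 : ℝ) ≠ 0 := by
    exact_mod_cast (Nat.choose_pos (Nat.le_add_right _ _)).ne'
  push_cast
  field_simp

/-- If `P` and `Q` are distributions and `P k ≤ Q k` away from a single point `a`,
then their total variation distance is `P a - Q a`. -/
theorem dtv_eq_sub_of_le_off_point {P Q : ℕ → ℝ} (hP : HasSum P 1) (hQ : HasSum Q 1) (a : ℕ)
    (h : ∀ k, k ≠ a → P k ≤ Q k) (ha : Q a ≤ P a) : dtv P Q = P a - Q a := by
  have h1 : HasSum (fun k => if k = a then 2 * (P a - Q a) else 0) (2 * (P a - Q a)) :=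
    hasSum_ite_eq a _
  have h2 := (hQ.sub hP).add h1
  have h3 : (fun k => |P k - Q k|) =
      fun k => Q k - P k + if k = a then 2 * (P a - Q a) else 0 := by
    ext k
    split_ifs with hk
    · subst hk
      rw [abs_of_nonneg (by linarith)]
      ring
    · rw [abs_of_nonpos (by linarith [h k hk])]
      ring
  rw [dtv, h3, h2.tsum_eq]
  ring

theorem dtv_bernoulli_poisson {p l : ℝ} (hl : 0 ≤ l) (hpl : 1 - p ≤ Real.exp (-l)) :
    dtv (binomPMF 1 p) (poissonPMF l) = p - l * Real.exp (-l) := by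
  have h := dtv_eq_sub_of_le_off_point (hasSum_binomPMF 1 p) (hasSum_poissonPMF l) 1 ?_ ?_
  · rw [h]
    simp [binomPMF, poissonPMF, mul_comm]
  · rintro (_ | _ | k) hk
    · simpa [binomPMF, poissonPMF] using hpl
    · exact absurd rfl hk
    · refine le_of_eq_of_le ?_ (poissonPMF_nonneg hl _)
      rw [binomPMF, Nat.choose_eq_zero_of_lt (by omega)]
      simp
  · have h1 : (1 + l) * Real.exp (-l) ≤ 1 := by
      calc (1 + l) * Real.exp (-l) ≤ Real.exp l * Real.exp (-l) := by
            gcongr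
            linarith [Real.add_one_le_exp l]
        _ = 1 := by rw [← Real.exp_add, add_neg_cancel, Real.exp_zero]
    simp only [binomPMF, poissonPMF]
    norm_num
    linarith

theorem dtv_binom_poisson_le {p l : ℝ} (hp0 : 0 ≤ p) (hp1 : p ≤ 1) (hl : 0 ≤ l)
    (hpl : 1 - p ≤ Real.exp (-l)) (n : ℕ) :
    dtv (binomPMF n p) (poissonPMF (n * l)) ≤ n * (p - l * Real.exp (-l)) := by
  induction n with
  | zero =>
    have h : binomPMF 0 p = poissonPMF 0 := by
      ext (_ | k) <;> simp [binomPMF, poissonPMF]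
    simp [h, dtv]
  | succ n ih =>
    have hc := dtv_convolution_le (hasSum_binomPMF n p) (hasSum_poissonPMF (n * l))
      (hasSum_binomPMF 1 p) (hasSum_poissonPMF l) (poissonPMF_nonneg (by positivity))
      (binomPMF_nonneg hp0 hp1 1)
    rw [← binomPMF_add, ← poissonPMF_add, dtv_bernoulli_poisson hl hpl] at hc
    push_cast
    rw [add_one_mul, add_one_mul]
    linarith

theorem stmt_5 (n : ℕ) (hn : 1 ≤ n) (p : ℝ) (hp : p ∈ Set.Ioo (0 : ℝ) 1) :
    (p ≤ 1 - Real.exp (-1) →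
      dtv (binomPMF n p) (poissonPMF ((n : ℝ) * min (-Real.log (1 - p)) 1)) ≤
        (n : ℝ) * (p + (1 - p) * Real.log (1 - p))) ∧
    (1 - Real.exp (-1) ≤ p →
      dtv (binomPMF n p) (poissonPMF ((n : ℝ) * min (-Real.log (1 - p)) 1)) ≤
        (n : ℝ) * (p - Real.exp (-1))) := by
  obtain ⟨hp0, hp1⟩ := hp
  have hq : 0 < 1 - p := sub_pos.2 hp1
  constructor
  · intro h
    have hl : -Real.log (1 - p) ≤ 1 := by
      linarith [(Real.le_log_iff_exp_le hq).2 (by linarith : Real.exp (-1) ≤ 1 - p)]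
    have hlog : Real.log (1 - p) ≤ 0 := Real.log_nonpos hq.le (by linarith)
    rw [min_eq_left hl]
    refine (dtv_binom_poisson_le hp0.le hp1.le (by linarith) ?_ n).trans_eq ?_
    · rw [neg_neg, Real.exp_log hq]
    · rw [neg_neg, Real.exp_log hq]
      ring
  · intro h
    have hl : 1 ≤ -Real.log (1 - p) := by
      linarith [(Real.log_le_iff_le_exp hq).2 (by linarith : 1 - p ≤ Real.exp (-1))]
    rw [min_eq_right hl]
    simpa using dtv_binom_poisson_le hp0.le hp1.le zero_le_one (by linarith) n
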